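/- Let D be a lower semicontinuous metric on ℂ such that: (ℂ, D) is a length space; the Euclidean metric is continuous with respect to D; every D-bounded subset of ℂ is bounded in the Euclidean metric; any two nonsingular points of D are at finite D-distance from each other; and both the set of singular points of D and the set of nonsingular points of D are dense in ℂ in the Euclidean topology. Let U ⊆ ℂ be a bounded open set whose Euclidean boundary ∂U contains at least one nonsingular point. Then for every r > 0 there exist a point z ∈ U with D(z, ∂U) = r and a D-geodesic P : [0, r] → ℂ with P(0) ∈ ∂U, P(r) = z, whose D-length equals r, and such that P(t) ∈ U for every t ∈ (0, r]. -/

import Mathlib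

open scoped ENNReal
open Filter

/-- The `D`-length of a curve `P` over the interval `[a,b]`: the supremum over all
(monotone) partitions `a = t_0 ≤ t_1 ≤ ⋯ ≤ t_k = b` of the sums of the `D`-distances
between consecutive partition points. -/
noncomputable def pathLength (D : ℂ → ℂ → ℝ≥0∞) (P : ℝ → ℂ) (a b : ℝ) : ℝ≥0∞ :=
  ⨆ (k : ℕ) (t : Fin (k + 1) → ℝ) (_ : Monotone t) (_ : t 0 = a) (_ : t (Fin.last k) = b),
    ∑ i : Fin k, D (P (t i.castSucc)) (P (t i.succ))

/-- `(ℂ, D)` is a length space: for all `z, w`, `D z w` is the infimum of `D`-lengths of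
continuous paths from `z` to `w` (parametrized by `[0,1]`). -/
def IsLengthSpace (D : ℂ → ℂ → ℝ≥0∞) : Prop :=
  ∀ z w : ℂ, D z w =
    ⨅ (P : ℝ → ℂ) (_ : ContinuousOn P (Set.Icc 0 1)) (_ : P 0 = z) (_ : P 1 = w),
      pathLength D P 0 1

/-- `z` is a singular point of `D`: it is at infinite `D`-distance from every other point. -/
def IsSingularPt (D : ℂ → ℂ → ℝ≥0∞) (z : ℂ) : Prop :=
  ∀ w : ℂ, w ≠ z → D z w = ⊤


lemma aux_closed {D : ℂ → ℂ → ℝ≥0∞}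
    (hlsc : LowerSemicontinuous (fun p : ℂ × ℂ => D p.1 p.2)) (c : ℝ≥0∞) :
    IsClosed {p : ℂ × ℂ | D p.1 p.2 ≤ c} :=
  hlsc.isClosed_preimage c

lemma aux_le_pathLength (D : ℂ → ℂ → ℝ≥0∞) (P : ℝ → ℂ) (t : ℝ) (ht : t ∈ Set.Icc (0:ℝ) 1) :
    D (P 0) (P t) + D (P t) (P 1) ≤ pathLength D P 0 1 := by
  unfold pathLength
  refine le_iSup_of_le 2 (le_iSup_of_le ![0, t, 1] (le_iSup_of_le ?_
    (le_iSup_of_le rfl (le_iSup_of_le rfl ?_))))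
  · rw [Fin.monotone_iff_le_succ]
    intro i
    fin_cases i
    · exact ht.1
    · exact ht.2
  · rw [Fin.sum_univ_two]
    exact le_rfl

lemma aux_compact {D : ℂ → ℂ → ℝ≥0∞}
    (hsymm : ∀ x y, D x y = D y x)
    (htri : ∀ x y z, D x z ≤ D x y + D y z)
    (hlsc : LowerSemicontinuous (fun p : ℂ × ℂ => D p.1 p.2))
    (hbdd : ∀ Y : Set ℂ, (⨆ x ∈ Y, ⨆ y ∈ Y, D x y) < ⊤ → Bornology.IsBounded Y)
    (x : ℂ) (R : ℝ) : IsCompact {w : ℂ | D x w ≤ ENNReal.ofReal R} := by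
  refine Metric.isCompact_of_isClosed_isBounded ?_ ?_
  · exact (aux_closed hlsc (ENNReal.ofReal R)).preimage (f := fun w : ℂ => (x, w)) (by fun_prop)
  · apply hbdd
    refine lt_of_le_of_lt (b := ENNReal.ofReal R + ENNReal.ofReal R) ?_ (by simp)
    refine iSup₂_le fun a ha => iSup₂_le fun b hb => ?_
    refine (htri a x b).trans (add_le_add ?_ hb)
    rw [hsymm]; exact ha

/-- approximate intermediate points -/
lemma aux_between_approx {D : ℂ → ℂ → ℝ≥0∞}
    (hzero : ∀ x y, (D x y = 0 ↔ x = y))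
    (hlsc : LowerSemicontinuous (fun p : ℂ × ℂ => D p.1 p.2))
    (hlength : IsLengthSpace D)
    (x y : ℂ) (R s : ℝ) (hs : 0 ≤ s) (hsR : s ≤ R) (hxy : D x y ≤ ENNReal.ofReal R)
    (ε : ℝ) (hε : 0 < ε) :
    ∃ q, D x q ≤ ENNReal.ofReal (s + ε) ∧ D q y ≤ ENNReal.ofReal (R - s) := by
  have h1 : D x y < ENNReal.ofReal (R + ε) :=
    hxy.trans_lt ((ENNReal.ofReal_lt_ofReal_iff (by linarith)).2 (by linarith))
  rw [hlength x y] at h1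
  simp only [iInf_lt_iff] at h1
  obtain ⟨P, hP, rfl, rfl, hl⟩ := h1
  have hcov : ∀ t ∈ Set.Icc (0:ℝ) 1, D (P 0) (P t) ≤ ENNReal.ofReal (s + ε) ∨
      D (P t) (P 1) ≤ ENNReal.ofReal (R - s) := by
    intro t ht
    by_contra! hc
    have := (add_le_add hc.1.le hc.2.le).trans (aux_le_pathLength D P t ht)
    rw [← ENNReal.ofReal_add (by linarith) (by linarith)] at this
    have h2 := this.trans_lt hl
    rw [show s + ε + (R - s) = R + ε by ring] at h2
    exact lt_irrefl _ h2
  obtain ⟨A, hA, hA'⟩ := (continuousOn_iff_isClosed.1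
    (show ContinuousOn (fun t => (P 0, P t)) (Set.Icc (0:ℝ) 1) by fun_prop)) _
      (aux_closed hlsc (ENNReal.ofReal (s + ε)))
  obtain ⟨B, hB, hB'⟩ := (continuousOn_iff_isClosed.1
    (show ContinuousOn (fun t => (P t, P 1)) (Set.Icc (0:ℝ) 1) by fun_prop)) _
      (aux_closed hlsc (ENNReal.ofReal (R - s)))
  have hAi : ∀ t ∈ Set.Icc (0:ℝ) 1, (t ∈ A ↔ D (P 0) (P t) ≤ ENNReal.ofReal (s + ε)) := by
    intro t ht
    have := Set.ext_iff.1 hA' t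
    simp only [Set.mem_inter_iff, ht, and_true] at this
    exact this.symm
  have hBi : ∀ t ∈ Set.Icc (0:ℝ) 1, (t ∈ B ↔ D (P t) (P 1) ≤ ENNReal.ofReal (R - s)) := by
    intro t ht
    have := Set.ext_iff.1 hB' t
    simp only [Set.mem_inter_iff, ht, and_true] at this
    exact this.symm
  have hz : ∀ a, D a a = 0 := fun a => (hzero a a).2 rfl
  have h0 : (0:ℝ) ∈ Set.Icc (0:ℝ) 1 := by simp
  have h1 : (1:ℝ) ∈ Set.Icc (0:ℝ) 1 := by simp
  obtain ⟨t, ht, htA, htB⟩ := (isPreconnected_closed_iff.1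
    (isPreconnected_Icc (a := (0:ℝ)) (b := 1))) A B hA hB
    (fun t ht => (hcov t ht).imp (hAi t ht).2 (hBi t ht).2)
    ⟨0, h0, (hAi 0 h0).2 (by simp [hz])⟩ ⟨1, h1, (hBi 1 h1).2 (by simp [hz])⟩
  exact ⟨P t, (hAi t ht).1 htA, (hBi t ht).1 htB⟩

lemma aux_between {D : ℂ → ℂ → ℝ≥0∞}
    (hsymm : ∀ x y, D x y = D y x)
    (htri : ∀ x y z, D x z ≤ D x y + D y z)
    (hzero : ∀ x y, (D x y = 0 ↔ x = y))
    (hlsc : LowerSemicontinuous (fun p : ℂ × ℂ => D p.1 p.2))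
    (hlength : IsLengthSpace D)
    (hbdd : ∀ Y : Set ℂ, (⨆ x ∈ Y, ⨆ y ∈ Y, D x y) < ⊤ → Bornology.IsBounded Y)
    (x y : ℂ) (R s : ℝ) (hs : 0 ≤ s) (hsR : s ≤ R) (hxy : D x y ≤ ENNReal.ofReal R) :
    ∃ q, D x q ≤ ENNReal.ofReal s ∧ D q y ≤ ENNReal.ofReal (R - s) := by
  have hK := aux_compact hsymm htri hlsc hbdd y (R - s)
  have hlx : LowerSemicontinuous (fun w => D x w) :=
    hlsc.comp (f := fun p : ℂ × ℂ => D p.1 p.2) (g := fun w => (x, w)) (by fun_prop)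
  obtain ⟨q0, -, hq0⟩ := aux_between_approx hzero hlsc hlength x y R s hs hsR hxy 1 one_pos
  obtain ⟨q, hq, hmin⟩ := LowerSemicontinuousOn.exists_isMinOn (f := fun w => D x w)
    ⟨q0, by rw [Set.mem_ofPred_eq, hsymm]; exact hq0⟩ hK (hlx.lowerSemicontinuousOn _)
  refine ⟨q, ?_, by rw [hsymm]; exact hq⟩
  refine ENNReal.le_of_forall_pos_le_add fun ε hε _ => ?_
  obtain ⟨q', h1, h2⟩ := aux_between_approx hzero hlsc hlength x y R s hs hsR hxy ε
    (by exact_mod_cast hε)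
  have h3 : D x q ≤ D x q' := hmin (show D y q' ≤ _ by rw [hsymm]; exact h2)
  refine (h3.trans h1).trans ?_
  rw [ENNReal.ofReal_add hs (by positivity)]
  simp

lemma aux_finite {D : ℂ → ℂ → ℝ≥0∞}
    (hsymm : ∀ x y, D x y = D y x)
    (htri : ∀ x y z, D x z ≤ D x y + D y z)
    (hzero : ∀ x y, (D x y = 0 ↔ x = y))
    (hlsc : LowerSemicontinuous (fun p : ℂ × ℂ => D p.1 p.2))
    (hlength : IsLengthSpace D)
    (hbdd : ∀ Y : Set ℂ, (⨆ x ∈ Y, ⨆ y ∈ Y, D x y) < ⊤ → Bornology.IsBounded Y)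
    (x : ℂ) (F : Finset ℝ) : ∀ (y : ℂ) (R : ℝ), (∀ t ∈ F, 0 ≤ t ∧ t ≤ R) →
    D x y ≤ ENNReal.ofReal R →
    ∃ f : ℝ → ℂ, (∀ s ∈ F, D x (f s) ≤ ENNReal.ofReal s ∧ D (f s) y ≤ ENNReal.ofReal (R - s)) ∧
      ∀ s ∈ F, ∀ t ∈ F, s ≤ t → D (f s) (f t) ≤ ENNReal.ofReal (t - s) := by
  classical
  refine Finset.induction_on_max F ?_ ?_
  · intro y R _ _; exact ⟨fun _ => x, by simp, by simp⟩
  · intro m F hm ih y R hF hxy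
    obtain ⟨hm0, hmR⟩ := hF m (by simp)
    obtain ⟨q, hq1, hq2⟩ := aux_between hsymm htri hzero hlsc hlength hbdd x y R m hm0 hmR hxy
    obtain ⟨f, hf1, hf2⟩ := ih q m
      (fun t ht => ⟨(hF t (by simp [ht])).1, (hm t ht).le⟩) hq1
    have hne : ∀ s ∈ F, s ≠ m := fun s hs => (hm s hs).ne
    refine ⟨Function.update f m q, ?_, ?_⟩
    · intro s hs
      rcases Finset.mem_insert.1 hs with rfl | hs
      · simp [hq1, hq2]
      · rw [Function.update_of_ne (hne s hs)]
        refine ⟨(hf1 s hs).1, (htri _ q _).trans ((add_le_add (hf1 s hs).2 hq2).trans ?_)⟩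
        rw [← ENNReal.ofReal_add (by linarith [hm s hs]) (by linarith)]
        exact ENNReal.ofReal_le_ofReal (by linarith)
    · intro s hs t ht hst
      rcases Finset.mem_insert.1 hs with rfl | hsF
      · rcases Finset.mem_insert.1 ht with rfl | ht
        · simp [(hzero q q).2 rfl]
        · exact absurd (hm t ht) (not_lt.2 hst)
      · rcases Finset.mem_insert.1 ht with rfl | ht
        · rw [Function.update_of_ne (hne s hsF), Function.update_self]
          exact (hf1 s hsF).2
        · rw [Function.update_of_ne (hne s hsF), Function.update_of_ne (hne t ht)]
          exact hf2 s hsF t ht hst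

lemma aux_geodesic {D : ℂ → ℂ → ℝ≥0∞}
    (hsymm : ∀ x y, D x y = D y x)
    (htri : ∀ x y z, D x z ≤ D x y + D y z)
    (hzero : ∀ x y, (D x y = 0 ↔ x = y))
    (hlsc : LowerSemicontinuous (fun p : ℂ × ℂ => D p.1 p.2))
    (hlength : IsLengthSpace D)
    (hbdd : ∀ Y : Set ℂ, (⨆ x ∈ Y, ⨆ y ∈ Y, D x y) < ⊤ → Bornology.IsBounded Y)
    (x y : ℂ) (R : ℝ) (hxy : D x y ≤ ENNReal.ofReal R) :
    ∃ f : ℝ → ℂ, (∀ s ∈ Set.Icc 0 R,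
        D x (f s) ≤ ENNReal.ofReal s ∧ D (f s) y ≤ ENNReal.ofReal (R - s)) ∧
      ∀ s ∈ Set.Icc 0 R, ∀ t ∈ Set.Icc 0 R, s ≤ t →
        D (f s) (f t) ≤ ENNReal.ofReal (t - s) := by
  classical
  have key := fun F : Finset ℝ => aux_finite hsymm htri hzero hlsc hlength hbdd x
    (F.filter (fun t => t ∈ Set.Icc 0 R)) y R
    (fun t ht => (Finset.mem_filter.1 ht).2) hxy
  choose g hg1 hg2 using key
  let u : Ultrafilter (Finset ℝ) := Ultrafilter.of atTop
  have hu : (u : Filter (Finset ℝ)) ≤ atTop := Ultrafilter.of_le _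
  have hmem : ∀ t ∈ Set.Icc 0 R, ∀ᶠ F in (u : Filter (Finset ℝ)),
      t ∈ F.filter (fun t => t ∈ Set.Icc 0 R) := by
    intro t ht
    apply hu
    filter_upwards [eventually_ge_atTop ({t} : Finset ℝ)] with F hF
    exact Finset.mem_filter.2 ⟨hF (by simp), ht⟩
  have hlim : ∀ t, ∃ w, t ∈ Set.Icc 0 R →
      Tendsto (fun F => g F t) (u : Filter (Finset ℝ)) (nhds w) := by
    intro t
    by_cases ht : t ∈ Set.Icc 0 R
    · obtain ⟨w, -, hw⟩ := (aux_compact hsymm htri hlsc hbdd x t).ultrafilter_le_nhds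
        (u.map (fun F => g F t)) (by
          rw [le_principal_iff]
          change ∀ᶠ F in (u : Filter (Finset ℝ)), g F t ∈ _
          filter_upwards [hmem t ht] with F hF
          exact (hg1 F t hF).1)
      exact ⟨w, fun _ => hw⟩
    · exact ⟨0, fun h => absurd h ht⟩
  choose f hf using hlim
  refine ⟨f, fun s hs => ⟨?_, ?_⟩, fun s hs t ht hst => ?_⟩
  · refine (aux_closed hlsc (ENNReal.ofReal s)).mem_of_tendsto
      ((tendsto_const_nhds (x := x)).prodMk_nhds (hf s hs)) ?_
    filter_upwards [hmem s hs] with F hF using (hg1 F s hF).1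
  · refine (aux_closed hlsc (ENNReal.ofReal (R - s))).mem_of_tendsto
      ((hf s hs).prodMk_nhds (tendsto_const_nhds (x := y))) ?_
    filter_upwards [hmem s hs] with F hF using (hg1 F s hF).2
  · refine (aux_closed hlsc (ENNReal.ofReal (t - s))).mem_of_tendsto
      ((hf s hs).prodMk_nhds (hf t ht)) ?_
    filter_upwards [hmem s hs, hmem t ht] with F hF hF' using hg2 F s hF t hF' hst

/-- Let `D` be a lower semicontinuous metric on `ℂ` such that: `(ℂ, D)` is
a length space; the Euclidean metric is continuous with respect to `D`; every `D`-bounded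
set is Euclidean-bounded; any two nonsingular points are at finite `D`-distance; and both
the singular and the nonsingular points are Euclidean-dense.  Let `U` be a bounded open set
whose Euclidean boundary contains a nonsingular point.  Then for every `r > 0` there exist a
point `z ∈ U` with `D(z, ∂U) = r` and a `D`-geodesic `P : [0,r] → ℂ` from `∂U` to `z` of
`D`-length `r` with `P(t) ∈ U` for all `t ∈ (0, r]`. -/
theorem exists_geodesic_from_boundary (D : ℂ → ℂ → ℝ≥0∞)
    (hsymm : ∀ x y, D x y = D y x)
    (htri : ∀ x y z, D x z ≤ D x y + D y z)
    (hzero : ∀ x y, (D x y = 0 ↔ x = y))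
    (hlsc : LowerSemicontinuous (fun p : ℂ × ℂ => D p.1 p.2))
    (hlength : IsLengthSpace D)
    (heucl : ∀ (z : ℂ) (w : ℕ → ℂ),
      Tendsto (fun n => D (w n) z) atTop (nhds 0) → Tendsto w atTop (nhds z))
    (hbdd : ∀ Y : Set ℂ, (⨆ x ∈ Y, ⨆ y ∈ Y, D x y) < ⊤ → Bornology.IsBounded Y)
    (hfin : ∀ z w : ℂ, ¬ IsSingularPt D z → ¬ IsSingularPt D w → D z w < ⊤)
    (hsingDense : Dense {z : ℂ | IsSingularPt D z})
    (hnonsingDense : Dense {z : ℂ | ¬ IsSingularPt D z})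
    (U : Set ℂ) (hUopen : IsOpen U) (hUbdd : Bornology.IsBounded U)
    (hbdryPt : ∃ p ∈ frontier U, ¬ IsSingularPt D p)
    (r : ℝ) (hr : 0 < r) :
    ∃ z ∈ U, (⨅ x ∈ frontier U, D z x) = ENNReal.ofReal r ∧
      ∃ P : ℝ → ℂ, ContinuousOn P (Set.Icc 0 r) ∧ P 0 ∈ frontier U ∧ P r = z ∧
        pathLength D P 0 r = ENNReal.ofReal r ∧ ∀ t ∈ Set.Ioc (0 : ℝ) r, P t ∈ U := by
  have hz : ∀ a, D a a = 0 := fun a => (hzero a a).2 rfl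
  obtain ⟨p, hp, hpns⟩ := hbdryPt
  have hdisj : Disjoint U (frontier U) := by
    have := hUopen.inter_frontier_eq
    exact Set.disjoint_iff_inter_eq_empty.2 this
  have hcpt : IsCompact (frontier U) :=
    Metric.isCompact_of_isClosed_isBounded isClosed_frontier
      (hUbdd.closure.subset frontier_subset_closure)
  have hUne : U.Nonempty := closure_nonempty_iff.1 ⟨p, frontier_subset_closure hp⟩
  obtain ⟨s, hsU, hs⟩ := hsingDense.exists_mem_open hUopen hUne |>.imp fun _ h => h.symm
  have hV : ∀ᶠ w in nhds s, ∀ x ∈ frontier U, ENNReal.ofReal r < D w x := by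
    refine hcpt.eventually_forall_of_forall_eventually fun x hx => ?_
    refine hlsc (s, x) _ ?_
    have : x ≠ s := fun h => Set.disjoint_left.1 hdisj hsU (h ▸ hx)
    simp [hs x this]
  obtain ⟨z, ⟨hzU, hzr⟩, hzns⟩ := hnonsingDense.inter_nhds_nonempty
    (inter_mem (hUopen.mem_nhds hsU) hV)|>.imp fun _ h => h.symm
  have hlz : LowerSemicontinuous (fun w => D z w) :=
    hlsc.comp (f := fun p : ℂ × ℂ => D p.1 p.2) (g := fun w => (z, w)) (by fun_prop)
  obtain ⟨x0, hx0, hmin⟩ := LowerSemicontinuousOn.exists_isMinOn (f := fun w => D z w)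
    ⟨p, hp⟩ hcpt (hlz.lowerSemicontinuousOn _)
  have hmin' : ∀ x ∈ frontier U, D z x0 ≤ D z x := fun x hx => hmin hx
  have hfinz : D z x0 < ⊤ := (hmin' p hp).trans_lt (hfin z p hzns hpns)
  obtain ⟨R, hR0, hR⟩ : ∃ R : ℝ, 0 ≤ R ∧ D z x0 = ENNReal.ofReal R :=
    ⟨(D z x0).toReal, ENNReal.toReal_nonneg, (ENNReal.ofReal_toReal hfinz.ne).symm⟩
  have hrR : r < R := by
    have := hzr x0 hx0
    rw [hR] at this
    exact (ENNReal.ofReal_lt_ofReal_iff_of_nonneg hr.le).1 this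
  obtain ⟨f, hf1, hf2⟩ := aux_geodesic hsymm htri hzero hlsc hlength hbdd x0 z R
    (by rw [hsymm, hR])
  have hf0 : f 0 = x0 := by
    have := (hf1 0 ⟨le_rfl, hR0⟩).1
    simp only [ENNReal.ofReal_zero, nonpos_iff_eq_zero] at this
    exact ((hzero _ _).1 this).symm
  have hfR : f R = z := by
    have := (hf1 R ⟨hR0, le_rfl⟩).2
    simp only [sub_self, ENNReal.ofReal_zero, nonpos_iff_eq_zero] at this
    exact (hzero _ _).1 this
  have hiso : ∀ s ∈ Set.Icc 0 R, ∀ t ∈ Set.Icc 0 R, s ≤ t →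
      D (f s) (f t) = ENNReal.ofReal (t - s) := by
    intro s hs t ht hst
    refine le_antisymm (hf2 s hs t ht hst) ?_
    have h1 : ENNReal.ofReal R ≤ ENNReal.ofReal s + (D (f s) (f t) + ENNReal.ofReal (R - t)) := by
      rw [← hR, hsymm]
      exact (htri _ (f s) _).trans (add_le_add (hf1 s hs).1
        ((htri _ (f t) _).trans (add_le_add le_rfl (hf1 t ht).2)))
    have hne : D (f s) (f t) ≠ ⊤ := ((hf2 s hs t ht hst).trans_lt ENNReal.ofReal_lt_top).ne
    rw [← ENNReal.ofReal_toReal hne] at h1 ⊢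
    rw [← ENNReal.ofReal_add ENNReal.toReal_nonneg (by linarith [ht.2]),
      ← ENNReal.ofReal_add hs.1 (by linarith [ht.2, ENNReal.toReal_nonneg (a := D (f s) (f t))]),
      ENNReal.ofReal_le_ofReal_iff (by linarith [ht.2, hs.1, ENNReal.toReal_nonneg (a := D (f s) (f t))])] at h1
    exact ENNReal.ofReal_le_ofReal (by linarith)
  have habs : ∀ s ∈ Set.Icc 0 R, ∀ t ∈ Set.Icc 0 R,
      D (f s) (f t) = ENNReal.ofReal |t - s| := by
    intro s hs t ht
    rcases le_total s t with h | h
    · rw [hiso s hs t ht h, abs_of_nonneg (by linarith)]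
    · rw [hsymm, hiso t ht s hs h, abs_of_nonpos (by linarith), neg_sub]
  have hcont : ContinuousOn f (Set.Icc 0 R) := by
    rw [continuousOn_iff_continuous_domRestrict, continuous_iff_seqContinuous]
    intro v t hv
    refine heucl _ _ ?_
    have : ∀ n, D (Set.domRestrict (Set.Icc 0 R) f (v n)) (Set.domRestrict (Set.Icc 0 R) f t)
        = ENNReal.ofReal |(t : ℝ) - v n| := fun n => habs _ (v n).2 _ t.2
    refine Tendsto.congr (fun n => (this n).symm) ?_
    have hv' : Tendsto (fun n => ((v n : ℝ))) atTop (nhds (t : ℝ)) :=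
      (continuous_subtype_val.tendsto t).comp hv
    have := ENNReal.tendsto_ofReal ((tendsto_const_nhds (x := (t : ℝ))).sub hv').abs
    simpa using this
  have hrI : r ∈ Set.Icc 0 R := ⟨hr.le, hrR.le⟩
  have h0I : (0:ℝ) ∈ Set.Icc 0 R := ⟨le_rfl, hR0⟩
  have hRI : R ∈ Set.Icc 0 R := ⟨hR0, le_rfl⟩
  have hnf : ∀ t ∈ Set.Ioc 0 R, f t ∉ frontier U := by
    intro t ht hft
    have h1 := hmin' _ hft
    rw [hR, hsymm, ← hfR, hiso t ⟨ht.1.le, ht.2⟩ R hRI ht.2,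
      ENNReal.ofReal_le_ofReal_iff (by linarith [ht.2])] at h1
    linarith [ht.1]
  have hU : ∀ t ∈ Set.Ioc 0 R, f t ∈ U := by
    have hpre : IsPreconnected (f '' Set.Ioc 0 R) :=
      isPreconnected_Ioc.image f (hcont.mono Set.Ioc_subset_Icc_self)
    have hRm : R ∈ Set.Ioc 0 R := ⟨hr.trans hrR, le_rfl⟩
    intro t ht
    refine hpre.subset_of_closure_inter_subset hUopen
      ⟨z, ⟨R, hRm, hfR⟩, hzU⟩ ?_ ⟨t, ht, rfl⟩
    rintro _ ⟨hw, t', ht', rfl⟩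
    by_contra hc
    exact hnf t' ht' (hUopen.frontier_eq ▸ ⟨hw, hc⟩)
  refine ⟨f r, hU r ⟨hr, hrR.le⟩, ?_, f, hcont.mono (Set.Icc_subset_Icc_right hrR.le),
    hf0 ▸ hx0, rfl, ?_, fun t ht => hU t ⟨ht.1, ht.2.trans hrR.le⟩⟩
  · refine le_antisymm (iInf₂_le_of_le x0 hx0 ?_) (le_iInf₂ fun x hx => ?_)
    · rw [hsymm]; exact (hf1 r hrI).1
    · have h1 : ENNReal.ofReal R ≤ ENNReal.ofReal (R - r) + D (f r) x := by
        rw [← hR]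
        refine (hmin' x hx).trans ((htri _ (f r) _).trans (add_le_add ?_ le_rfl))
        rw [hsymm]; exact (hf1 r hrI).2
      rw [show R = (R - r) + r by ring, ENNReal.ofReal_add (by linarith) hr.le,
        show (R - r) + r = R by ring] at h1
      exact (ENNReal.add_le_add_iff_left ENNReal.ofReal_ne_top).1 h1
  · unfold pathLength
    have hsum : ∀ (k : ℕ) (t : Fin (k + 1) → ℝ), Monotone t → t 0 = 0 → t (Fin.last k) = r →
        ∑ i : Fin k, D (f (t i.castSucc)) (f (t i.succ)) = ENNReal.ofReal r := by
      intro k t ht h0 h1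
      have hI : ∀ i, t i ∈ Set.Icc 0 R := fun i =>
        ⟨h0 ▸ ht (Fin.zero_le i), (ht (Fin.le_last i)).trans (h1 ▸ hrR.le)⟩
      have hle : ∀ i : Fin k, t i.castSucc ≤ t i.succ := fun i =>
        ht (Fin.castSucc_lt_succ (i := i)).le
      rw [Finset.sum_congr rfl (fun i _ => hiso _ (hI i.castSucc) _ (hI i.succ) (hle i)),
        ← ENNReal.ofReal_sum_of_nonneg (fun i _ => sub_nonneg.2 (hle i)), Finset.sum_sub_distrib]
      have e1 := Fin.sum_univ_succ t
      have e2 := Fin.sum_univ_castSucc t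
      congr 1
      linarith
    refine le_antisymm ?_ ?_
    · exact iSup_le fun k => iSup_le fun t => iSup_le fun ht => iSup_le fun h0 => iSup_le fun h1 =>
        (hsum k t ht h0 h1).le
    · have hm : Monotone ![0, r] := by
        rw [Fin.monotone_iff_le_succ]
        intro i
        fin_cases i
        exact hr.le
      exact le_iSup_of_le 1 (le_iSup_of_le ![0, r] (le_iSup_of_le hm
        (le_iSup_of_le rfl (le_iSup_of_le rfl (hsum 1 _ hm rfl rfl).ge))))
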